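/- Let G be a finite simple graph with a round representation (r, β) on ZMod n such that 𝒢(r) is connected, and let a ≠ b be points forming a disconnectable pair ⟨a, b⟩ (i.e., b = F_r a and a = F_l b). Let B_l ⊆ β⁻¹(a) and B_r ⊆ β⁻¹(b). Then the graph obtained from G by deleting every edge with one endpoint in B_l and the other endpoint in B_r is a PCA graph. -/

import Mathlib

open Classical

noncomputable section

def IsRoundRep (n : ℕ) (r : ZMod n → ℕ) : Prop :=
  (∀ i, r i < n) ∧ (∀ i, r i ≤ r (i + 1) + 1)

def Arrow {n : ℕ} (r : ZMod n → ℕ) (i j : ZMod n) : Prop :=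
  ∃ k : ℕ, 1 ≤ k ∧ k ≤ r i ∧ j = i + (k : ZMod n)

def Fr {n : ℕ} (r : ZMod n → ℕ) (i : ZMod n) : ZMod n := i + (r i : ZMod n)

def Fl {n : ℕ} (r : ZMod n → ℕ) (i : ZMod n) : ZMod n :=
  i - (({j : ZMod n | Arrow r j i}).ncard : ZMod n)

def Nr {n : ℕ} (r : ZMod n → ℕ) (i : ZMod n) : ZMod n :=
  if Arrow r i (i + 1) then i + 1 else i

def Nl {n : ℕ} (r : ZMod n → ℕ) (i : ZMod n) : ZMod n :=
  if Arrow r (i - 1) i then i - 1 else i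

def Ur {n : ℕ} (r : ZMod n → ℕ) (i : ZMod n) : ZMod n := Fr r i + 1

def Ul {n : ℕ} (r : ZMod n → ℕ) (i : ZMod n) : ZMod n := Fl r i - 1

def IsNormal {n : ℕ} (r : ZMod n → ℕ) : Prop :=
  ∀ i j : ZMod n, i ≠ j → ¬(Arrow r i j ∧ Arrow r j i)

def roundGraph {n : ℕ} (r : ZMod n → ℕ) : SimpleGraph (ZMod n) :=
  SimpleGraph.fromRel (Arrow r)

def IsStraight {n : ℕ} (r : ZMod n → ℕ) : Prop := ∃ i, r i = 0

def cyclicRange {n : ℕ} (a b : ZMod n) : Set (ZMod n) :=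
  {x | ∃ k : ℕ, k ≤ (b - a).val ∧ x = a + (k : ZMod n)}

def cyclicRangeCO {n : ℕ} (a b : ZMod n) : Set (ZMod n) := cyclicRange a b \ {b}

def cyclicRangeOC {n : ℕ} (a b : ZMod n) : Set (ZMod n) := cyclicRange a b \ {a}

def cyclicRangeOO {n : ℕ} (a b : ZMod n) : Set (ZMod n) := cyclicRange a b \ {a, b}

def coNbhd {V : Type*} (G : SimpleGraph V) (v : V) : Set V :=
  {w | w ≠ v ∧ ¬ G.Adj v w}

def coNbhdSet {V : Type*} (G : SimpleGraph V) (S : Set V) : Set V :=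
  ⋃ v ∈ S, coNbhd G v

def IsBipartite {V : Type*} (G : SimpleGraph V) : Prop :=
  ∃ S : Set V, ∀ v w, G.Adj v w → (v ∈ S ↔ w ∉ S)

def IsUniversalPt {n : ℕ} (r : ZMod n → ℕ) (i : ZMod n) : Prop :=
  ∀ j, j ≠ i → (roundGraph r).Adj i j

def Compressed {n : ℕ} (r : ZMod n → ℕ) : Prop :=
  ∀ i j : ZMod n, Fl r i = Fl r j → Fr r i = Fr r j → i = j

def IsRoundRepOf {V : Type*} (G : SimpleGraph V) (n : ℕ) (r : ZMod n → ℕ)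
    (β : V → ZMod n) : Prop :=
  IsRoundRep n r ∧ IsNormal r ∧ Function.Surjective β ∧
    ∀ u v : V, u ≠ v → (G.Adj u v ↔ (β u = β v ∨ (roundGraph r).Adj (β u) (β v)))

def IsPCA {V : Type*} (G : SimpleGraph V) : Prop :=
  ∃ n : ℕ, 1 ≤ n ∧ ∃ (r : ZMod n → ℕ) (β : V → ZMod n), IsRoundRepOf G n r β

def IsPIG {V : Type*} (G : SimpleGraph V) : Prop :=
  ∃ n : ℕ, 1 ≤ n ∧ ∃ (r : ZMod n → ℕ) (β : V → ZMod n),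
    IsRoundRepOf G n r β ∧ IsStraight r

def IsBlockContigOf {V : Type*} (G : SimpleGraph V) (n : ℕ) (r : ZMod n → ℕ)
    (β : V → ZMod n) : Prop :=
  IsRoundRepOf G n r β ∧ Compressed r ∧
    {i : ZMod n | IsUniversalPt r i}.Subsingleton ∧ (roundGraph r).Connected

def Disconnectable {n : ℕ} (r : ZMod n → ℕ) (a b : ZMod n) : Prop :=
  b = Fr r a ∧ a = Fl r b

def Connectable {n : ℕ} (r : ZMod n → ℕ) (a b : ZMod n) : Prop :=
  b = Ur r a ∧ a = Ul r b

def addEdge {V : Type*} (G : SimpleGraph V) (v w : V) : SimpleGraph V :=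
  G ⊔ SimpleGraph.fromRel (fun x y => x = v ∧ y = w)

def IsCoContigChunk {n : ℕ} (r : ZMod n → ℕ) (S : Set (ZMod n)) : Prop :=
  (∃ a b : ZMod n, S = cyclicRange a b) ∧
  ∃ X : Set (ZMod n), S ⊆ X ∧
    (∃ C : ((roundGraph r)ᶜ).ConnectedComponent,
      X ∪ coNbhdSet (roundGraph r) X = C.supp) ∧
    X ∩ coNbhdSet (roundGraph r) X = ∅ ∧
    (roundGraph r).IsClique X ∧ (roundGraph r).IsClique (coNbhdSet (roundGraph r) X)

def phi {n : ℕ} (w : ZMod (n + 1)) (k : ZMod n) : ZMod (n + 1) :=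
  w + 1 + (k.val : ZMod (n + 1))

def removePt {n : ℕ} (s : ZMod (n + 1) → ℕ) (w : ZMod (n + 1)) (k : ZMod n) : ℕ :=
  if Arrow s (phi w k) w then s (phi w k) - 1 else s (phi w k)

def Receptive {n : ℕ} (r : ZMod n → ℕ) (Bl Br : ZMod n) : Prop :=
  ∃ (s : ZMod (n + 1) → ℕ) (w : ZMod (n + 1)),
    IsRoundRep (n + 1) s ∧ IsNormal s ∧ (roundGraph s).Connected ∧
    Fl s w ≠ w ∧ Fr s w ≠ w ∧ removePt s w = r ∧
    phi w Bl = Fl s w ∧ phi w Br = Fr s w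

def dominoGraph : SimpleGraph (Fin 6) :=
  SimpleGraph.fromRel (fun i j =>
    (i, j) = (0, 1) ∨ (i, j) = (1, 2) ∨ (i, j) = (3, 4) ∨ (i, j) = (4, 5) ∨
    (i, j) = (0, 3) ∨ (i, j) = (1, 4) ∨ (i, j) = (2, 5))

def pGraph : SimpleGraph (Fin 5) :=
  SimpleGraph.fromRel (fun i j =>
    (i, j) = (0, 1) ∨ (i, j) = (1, 2) ∨ (i, j) = (3, 4) ∨
    (i, j) = (0, 3) ∨ (i, j) = (1, 4))

def AlmostConnectable {V : Type*} {n : ℕ} (r : ZMod n → ℕ) (β : V → ZMod n)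
    (a b : ZMod n) : Prop :=
  (∃ v : V, β ⁻¹' {a} = {v}) ∧ (∃ w : V, β ⁻¹' {b} = {w}) ∧
  ∃ (hab : a ≠ b) (C : (((roundGraph r).induce {x : ZMod n | x ≠ b})ᶜ).ConnectedComponent)
    (D : Set (ZMod n)),
      (⟨a, hab⟩ : {x : ZMod n | x ≠ b}) ∈ C.supp ∧
      D = Subtype.val '' C.supp ∧
      Nonempty ((roundGraph r).induce D ≃g pGraphᶜ) ∧
      Nonempty ((roundGraph r).induce (D ∪ {b}) ≃g dominoGraphᶜ) ∧
      Nonempty ((roundGraph r).induce ((D ∪ {b}) \ {a}) ≃g pGraphᶜ)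

/-- The arrow relation of a round representation, read on the representatives `0, …, n - 1`. -/
def NatArrow (n : ℕ) (R : ℕ → ℕ) (i j : ℕ) : Prop :=
  (i < j ∧ j ≤ i + R i) ∨ (j < i ∧ j + n ≤ i + R i)

/-- A normal round representation of a graph, with points labelled by `0, …, n - 1`. -/
structure NatRep {V : Type*} (G : SimpleGraph V) (n : ℕ) (R : ℕ → ℕ) (β : V → ℕ) : Prop where
  pos : 0 < n
  lt : ∀ i, i < n → R i < n
  step : ∀ i, i + 1 < n → R i ≤ R (i + 1) + 1
  wrap : R (n - 1) ≤ R 0 + 1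
  normal : ∀ i j, i < n → j < n → NatArrow n R i j → ¬ NatArrow n R j i
  map_lt : ∀ v, β v < n
  surj : ∀ k, k < n → ∃ v, β v = k
  adj : ∀ u v, u ≠ v → (G.Adj u v ↔
    (β u = β v ∨ NatArrow n R (β u) (β v) ∨ NatArrow n R (β v) (β u)))

/-- The pair `(a, b)` is disconnectable, for points labelled by `0, …, n - 1`. -/
structure NatDisc (n : ℕ) (R : ℕ → ℕ) (a b : ℕ) : Prop where
  left_lt : a < n
  right_lt : b < n
  pos : 0 < R a
  eq : a + R a = b ∨ a + R a = b + n
  pred : ∀ i, i < n → (i + 1 = a ∨ a = 0 ∧ i + 1 = n) → R i ≤ R a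

/-- The representation obtained by splitting the point `c` into the twins `c` and `c + 1`. -/
def splitR (n : ℕ) (R : ℕ → ℕ) (c k : ℕ) : ℕ :=
  if k ≤ c then (if c ≤ k + R k then R k + 1 else R k)
  else (if n + c ≤ k - 1 + R (k - 1) then R (k - 1) + 1 else R (k - 1))

/-- The labelling after splitting `c`: the vertices at `c` outside `S` move to `c + 1`. -/
def splitMap {V : Type*} (β : V → ℕ) (c : ℕ) (S : Set V) (v : V) : ℕ :=
  if β v < c ∨ (β v = c ∧ v ∈ S) then β v else β v + 1

lemma natArrow_splitR_iff {n c : ℕ} {R : ℕ → ℕ} (hR : ∀ i, i < n → R i < n) (hc : c < n)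
    {i j : ℕ} (hi : i < n + 1) (hj : j < n + 1) :
    NatArrow (n + 1) (splitR n R c) i j ↔
      (i = c ∧ j = c + 1) ∨ NatArrow n R (if i ≤ c then i else i - 1)
        (if j ≤ c then j else j - 1) := by
  unfold NatArrow splitR
  have h1 : i < n → R i < n := hR i
  have h2 : i - 1 < n → R (i - 1) < n := hR (i - 1)
  by_cases hic : i ≤ c
  · simp only [hic, if_true]
    by_cases hjc : j ≤ c
    · simp only [hjc, if_true]
      split_ifs <;> omega
    · simp only [hjc, if_false]
      rcases eq_or_ne i c with rfl | hne <;> split_ifs <;> omega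
  · simp only [hic, if_false]
    by_cases hjc : j ≤ c
    · simp only [hjc, if_true]
      split_ifs <;> omega
    · simp only [hjc, if_false]
      split_ifs <;> omega

lemma splitMap_cases {V : Type*} (β : V → ℕ) (c : ℕ) (S : Set V) (v : V) :
    splitMap β c S v = β v ∧ β v ≤ c ∨ splitMap β c S v = β v + 1 ∧ c ≤ β v := by
  unfold splitMap
  split_ifs <;> omega

lemma exists_splitMap_eq {V : Type*} {β : V → ℕ} {n c : ℕ} {S : Set V}
    (hβ : ∀ k, k < n → ∃ v, β v = k) (hc : c < n) (hS : ∃ v ∈ S, β v = c) (hS' : ∃ v ∉ S, β v = c)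
    {k : ℕ} (hk : k < n + 1) : ∃ v, splitMap β c S v = k := by
  unfold splitMap
  rcases lt_trichotomy k c with hkc | rfl | hkc
  · obtain ⟨w, hw⟩ := hβ k (by omega)
    exact ⟨w, by rw [if_pos (by omega)]; exact hw⟩
  · obtain ⟨v, hvS, hv⟩ := hS
    exact ⟨v, by rw [if_pos (Or.inr ⟨hv, hvS⟩)]; exact hv⟩
  · rcases eq_or_ne k (c + 1) with rfl | hne
    · obtain ⟨v, hvS, hv⟩ := hS'
      refine ⟨v, ?_⟩
      rw [if_neg, hv]
      rintro (h | h)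
      · omega
      · exact hvS h.2
    · obtain ⟨v, hv⟩ := hβ (k - 1) (by omega)
      exact ⟨v, by rw [if_neg (by omega)]; omega⟩

lemma splitR_lt {n c : ℕ} {R : ℕ → ℕ} (hR : ∀ i, i < n → R i < n) (hc : c < n) {i : ℕ}
    (hi : i < n + 1) : splitR n R c i < n + 1 := by
  unfold splitR
  have h1 : i < n → R i < n := hR i
  have h2 : i - 1 < n → R (i - 1) < n := hR (i - 1)
  split_ifs <;> omega

lemma splitR_step {n c : ℕ} {R : ℕ → ℕ} (hstep : ∀ i, i + 1 < n → R i ≤ R (i + 1) + 1)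
    (hc : c < n) {i : ℕ} (hi : i + 1 < n + 1) :
    splitR n R c i ≤ splitR n R c (i + 1) + 1 := by
  unfold splitR
  rcases lt_trichotomy i c with hic | rfl | hic
  · have h1 := hstep i (by omega)
    split_ifs <;> omega
  · simp only [Nat.add_sub_cancel]
    split_ifs <;> omega
  · obtain ⟨k, rfl⟩ : ∃ k, i = k + 1 := ⟨i - 1, by omega⟩
    have h1 := hstep k (by omega)
    simp only [Nat.add_sub_cancel]
    split_ifs <;> omega

lemma splitR_wrap {n c : ℕ} {R : ℕ → ℕ} (hwrap : R (n - 1) ≤ R 0 + 1) (hc : c < n) :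
    splitR n R c n ≤ splitR n R c 0 + 1 := by
  unfold splitR
  split_ifs <;> omega

lemma NatRep.split {V : Type*} {G : SimpleGraph V} {n : ℕ} {R : ℕ → ℕ} {β : V → ℕ}
    (h : NatRep G n R β) {c : ℕ} (hc : c < n) {S : Set V}
    (hS : ∃ v ∈ S, β v = c) (hS' : ∃ v ∉ S, β v = c) :
    NatRep G (n + 1) (splitR n R c) (splitMap β c S) := by
  have hlt : ∀ v, splitMap β c S v < n + 1 := fun v => by
    have := h.map_lt v
    have := splitMap_cases β c S v
    omega
  refine ⟨by omega, fun i hi => splitR_lt h.lt hc hi, fun i hi => splitR_step h.step hc hi,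
    splitR_wrap h.wrap hc, ?_, hlt, fun k hk => exists_splitMap_eq h.surj hc hS hS' hk, ?_⟩
  · intro i j hi hj h1 h2
    rw [natArrow_splitR_iff h.lt hc hi hj] at h1
    rw [natArrow_splitR_iff h.lt hc hj hi] at h2
    have hirr : ¬ NatArrow n R c c := by
      have := h.lt c hc
      unfold NatArrow
      omega
    rcases h1 with ⟨rfl, rfl⟩ | h1
    · rcases h2 with h2 | h2
      · omega
      · simp at h2
        exact hirr h2
    · rcases h2 with ⟨rfl, rfl⟩ | h2
      · simp at h1
        exact hirr h1
      · exact h.normal _ _ (by split_ifs <;> omega) (by split_ifs <;> omega) h1 h2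
  · intro u v huv
    have hproj : ∀ v, (if splitMap β c S v ≤ c then splitMap β c S v
        else splitMap β c S v - 1) = β v := fun v => by
      have := splitMap_cases β c S v
      split_ifs <;> omega
    rw [h.adj u v huv, natArrow_splitR_iff h.lt hc (hlt u) (hlt v),
      natArrow_splitR_iff h.lt hc (hlt v) (hlt u), hproj, hproj]
    have key : β u = β v ↔ (splitMap β c S u = splitMap β c S v ∨
        (splitMap β c S u = c ∧ splitMap β c S v = c + 1) ∨
        (splitMap β c S v = c ∧ splitMap β c S u = c + 1)) := by
      have hu := splitMap_cases β c S u
      have hv := splitMap_cases β c S v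
      omega
    rw [key, or_assoc, or_assoc, or_assoc, or_left_comm (a := NatArrow n R _ _)]

lemma NatDisc.split_left {n a b : ℕ} {R : ℕ → ℕ} (hR : ∀ i, i < n → R i < n)
    (h : NatDisc n R a b) :
    NatDisc (n + 1) (splitR n R a) a (if b < a then b else b + 1) := by
  obtain ⟨ha, hb, hpos, heq, hpred⟩ := h
  have hRa := hR a ha
  have hval : splitR n R a a = R a + 1 := by simp [splitR]
  refine ⟨by omega, by split_ifs <;> omega, by omega, by split_ifs <;> omega, ?_⟩
  intro i hi hia
  rw [hval]
  unfold splitR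
  rcases hia with rfl | ⟨rfl, hi⟩
  · have := hpred i (by omega) (Or.inl rfl)
    split_ifs <;> omega
  · have := hpred (i - 1) (by omega) (Or.inr (by omega))
    split_ifs <;> omega

lemma NatDisc.split_right {n a b : ℕ} {R : ℕ → ℕ} (hR : ∀ i, i < n → R i < n)
    (h : NatDisc n R a b) :
    NatDisc (n + 1) (splitR n R b) (if a < b then a else a + 1) (b + 1) := by
  obtain ⟨ha, hb, hpos, heq, hpred⟩ := h
  have hRa := hR a ha
  have hab : a ≠ b := by omega
  have hval : splitR n R b (if a < b then a else a + 1) = R a + 1 := by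
    unfold splitR
    split_ifs with h1 h2 <;> simp_all <;> omega
  refine ⟨by split_ifs <;> omega, by omega, by omega, by rw [hval]; split_ifs <;> omega, ?_⟩
  intro i hi hia
  rw [hval]
  replace hia : a < b ∧ (i + 1 = a ∨ a = 0 ∧ i = n) ∨ b < a ∧ i = a := by
    rcases lt_or_gt_of_ne hab with h | h
    · rw [if_pos h] at hia
      omega
    · rw [if_neg h.not_gt] at hia
      omega
  have h1 : i < n → (i + 1 = a ∨ a = 0 ∧ i + 1 = n) → R i ≤ R a := hpred i
  have h2 : i - 1 < n → (i - 1 + 1 = a ∨ a = 0 ∧ i - 1 + 1 = n) → R (i - 1) ≤ R a :=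
    hpred (i - 1)
  unfold splitR
  split_ifs <;> omega

lemma NatRep.deleteEdges {V : Type*} {G : SimpleGraph V} {n a b : ℕ} {R : ℕ → ℕ} {β : V → ℕ}
    (h : NatRep G n R β) (hd : NatDisc n R a b) :
    NatRep (G.deleteEdges {e : Sym2 V | ∃ v ∈ β ⁻¹' {a}, ∃ w ∈ β ⁻¹' {b}, e = s(v, w)})
      n (Function.update R a (R a - 1)) β := by
  obtain ⟨ha, hb, hpos, heq, hpred⟩ := hd
  have hRa := h.lt a ha
  have harr : ∀ i j, i < n → j < n →
      (NatArrow n (Function.update R a (R a - 1)) i j ↔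
        NatArrow n R i j ∧ ¬ (i = a ∧ j = b)) := by
    intro i j hi hj
    unfold NatArrow
    rcases eq_or_ne i a with rfl | hia
    · rw [Function.update_self]
      omega
    · rw [Function.update_of_ne hia]
      omega
  have hab : NatArrow n R a b := by unfold NatArrow; omega
  have hba := h.normal a b ha hb hab
  refine ⟨h.pos, ?_, ?_, ?_, ?_, h.map_lt, h.surj, ?_⟩
  · intro i hi
    have := h.lt i hi
    rw [Function.update_apply]
    split_ifs <;> omega
  · intro i hi
    have h1 := h.step i hi
    have h2 := hpred i (by omega)
    rw [Function.update_apply, Function.update_apply]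
    split_ifs with h3 h4 h4
    · omega
    · subst h3; omega
    · subst h4; omega
    · omega
  · have h1 := h.wrap
    have h2 := hpred (n - 1) (by omega)
    rw [Function.update_apply, Function.update_apply]
    split_ifs with h3 h4 h4
    · omega
    · subst h3; omega
    · subst h4; omega
    · omega
  · intro i j hi hj h1 h2
    rw [harr _ _ hi hj] at h1
    rw [harr _ _ hj hi] at h2
    exact h.normal i j hi hj h1.1 h2.1
  · intro u v huv
    rw [harr _ _ (h.map_lt u) (h.map_lt v), harr _ _ (h.map_lt v) (h.map_lt u),
      SimpleGraph.deleteEdges_adj, h.adj u v huv]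
    have hmem : s(u, v) ∈ {e : Sym2 V | ∃ v ∈ β ⁻¹' {a}, ∃ w ∈ β ⁻¹' {b}, e = s(v, w)} ↔
        (β u = a ∧ β v = b) ∨ (β v = a ∧ β u = b) := by
      simp only [Set.mem_ofPred_eq, Set.mem_preimage, Set.mem_singleton_iff, Sym2.eq_iff]
      constructor
      · rintro ⟨x, hx, y, hy, ⟨rfl, rfl⟩ | ⟨rfl, rfl⟩⟩
        · exact Or.inl ⟨hx, hy⟩
        · exact Or.inr ⟨hx, hy⟩
      · rintro (⟨hx, hy⟩ | ⟨hx, hy⟩)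
        · exact ⟨u, hx, v, hy, Or.inl ⟨rfl, rfl⟩⟩
        · exact ⟨v, hx, u, hy, Or.inr ⟨rfl, rfl⟩⟩
    rw [hmem]
    have hne : a ≠ b := by omega
    by_cases h1 : β u = a ∧ β v = b
    · obtain ⟨h1, h2⟩ := h1
      rw [h1, h2]
      simp [hne, hba]
    · by_cases h2 : β v = a ∧ β u = b
      · obtain ⟨h2, h3⟩ := h2
        rw [h2, h3]
        simp [hne.symm, hba]
      · simp only [h1, h2, or_self, not_false_eq_true, and_true]

lemma arrow_iff_natArrow {n : ℕ} [NeZero n] {r : ZMod n → ℕ} (hr : ∀ i, r i < n)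
    (i j : ZMod n) :
    Arrow r i j ↔ NatArrow n (fun k => r (k : ZMod n)) i.val j.val := by
  have hi := ZMod.val_lt i
  have hj := ZMod.val_lt j
  have hri := hr i
  unfold Arrow NatArrow
  simp only [ZMod.natCast_zmod_val]
  constructor
  · rintro ⟨k, hk1, hk2, rfl⟩
    have hk : ((k : ZMod n)).val = k := ZMod.val_cast_of_lt (by omega)
    rcases lt_or_ge (i.val + k) n with h | h
    · rw [ZMod.val_add_of_lt (by omega), hk]
      omega
    · have := ZMod.val_add_val_of_le (a := i) (b := (k : ZMod n)) (by omega)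
      omega
  · rintro (⟨h1, h2⟩ | ⟨h1, h2⟩)
    · refine ⟨j.val - i.val, by omega, by omega, ?_⟩
      rw [Nat.cast_sub h1.le]
      simp
    · refine ⟨j.val + n - i.val, by omega, by omega, ?_⟩
      rw [Nat.cast_sub (by omega)]
      simp

lemma IsRoundRepOf.natRep {V : Type*} {G : SimpleGraph V} {n : ℕ} [NeZero n] {r : ZMod n → ℕ}
    {β : V → ZMod n} (h : IsRoundRepOf G n r β) :
    NatRep G n (fun k => r (k : ZMod n)) (fun v => (β v).val) := by
  obtain ⟨⟨hlt, hstep⟩, hnorm, hsurj, hadj⟩ := h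
  have hn : 0 < n := Nat.pos_of_ne_zero (NeZero.ne n)
  refine ⟨hn, fun i _ => hlt _, fun i _ => by simpa using hstep i, ?_, ?_,
    fun v => ZMod.val_lt _, ?_, ?_⟩
  · have := hstep ((n - 1 : ℕ) : ZMod n)
    rwa [← Nat.cast_succ, Nat.succ_eq_add_one, Nat.sub_add_cancel hn, ZMod.natCast_self,
      ← Nat.cast_zero] at this
  · intro i j hi hj h1 h2
    have hne : i ≠ j := by unfold NatArrow at h1; omega
    have hvi := ZMod.val_cast_of_lt hi
    have hvj := ZMod.val_cast_of_lt hj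
    refine hnorm (i : ZMod n) (j : ZMod n) (fun h => hne ?_) ⟨?_, ?_⟩
    · rw [← hvi, ← hvj, h]
    · rwa [arrow_iff_natArrow hlt, hvi, hvj]
    · rwa [arrow_iff_natArrow hlt, hvi, hvj]
  · intro k hk
    obtain ⟨v, hv⟩ := hsurj (k : ZMod n)
    exact ⟨v, by simp only [hv, ZMod.val_cast_of_lt hk]⟩
  · intro u v huv
    rw [hadj u v huv, ← arrow_iff_natArrow hlt, ← arrow_iff_natArrow hlt,
      (ZMod.val_injective n).eq_iff, roundGraph, SimpleGraph.fromRel_adj]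
    tauto

lemma NatRep.isPCA {V : Type*} {G : SimpleGraph V} {n : ℕ} {R : ℕ → ℕ} {β : V → ℕ}
    (h : NatRep G n R β) : IsPCA G := by
  have : NeZero n := ⟨h.pos.ne'⟩
  have hlt : ∀ i : ZMod n, R i.val < n := fun i => h.lt _ (ZMod.val_lt i)
  have harr : ∀ i j : ZMod n, Arrow (fun i : ZMod n => R i.val) i j ↔
      NatArrow n R i.val j.val := by
    intro i j
    rw [arrow_iff_natArrow hlt]
    simp [NatArrow]
  have hval : ∀ v, ((β v : ZMod n)).val = β v := fun v => ZMod.val_cast_of_lt (h.map_lt v)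
  refine ⟨n, h.pos, fun i => R i.val, fun v => (β v : ZMod n), ⟨hlt, ?_⟩, ?_, ?_, ?_⟩
  · intro i
    have hi := ZMod.val_lt i
    rcases Nat.lt_or_ge (i.val + 1) n with hi1 | hi1
    · have h1 : (i + 1).val = i.val + 1 := by
        rw [← ZMod.val_cast_of_lt hi1]
        simp
      simpa only [h1] using h.step _ hi1
    · have h1 : (i + 1).val = 0 := by
        have h2 : i + 1 = ((i.val + 1 : ℕ) : ZMod n) := by simp
        rw [h2, show i.val + 1 = n by omega]
        simp
      have h2 : i.val = n - 1 := by omega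
      simpa only [h1, h2] using h.wrap
  · rintro i j - ⟨h1, h2⟩
    rw [harr] at h1 h2
    exact h.normal _ _ (ZMod.val_lt i) (ZMod.val_lt j) h1 h2
  · intro i
    obtain ⟨v, hv⟩ := h.surj i.val (ZMod.val_lt i)
    exact ⟨v, by simp [hv]⟩
  · intro u v huv
    have heq : (β u : ZMod n) = (β v : ZMod n) ↔ β u = β v :=
      ⟨fun e => by rw [← hval u, ← hval v, e], fun e => by rw [e]⟩
    rw [h.adj u v huv, roundGraph, SimpleGraph.fromRel_adj, harr, harr, hval, hval, heq,
      ne_eq, heq]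
    tauto

lemma IsRoundRep.le_add {n : ℕ} {r : ZMod n → ℕ} (h : IsRoundRep n r) (i : ZMod n) (t : ℕ) :
    r i ≤ r (i + t) + t := by
  induction t with
  | zero => simp
  | succ t ih =>
    have := h.2 (i + t)
    rw [Nat.cast_succ, ← add_assoc i]
    omega

lemma Disconnectable.pred_le {n : ℕ} [NeZero n] {r : ZMod n → ℕ} (h : IsRoundRep n r)
    {a b : ZMod n} (hd : Disconnectable r a b) : r (a - 1) ≤ r a := by
  obtain ⟨hb, ha⟩ := hd
  by_contra! hlt
  set T : Set (ZMod n) := {j | Arrow r j b} with hT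
  have hra := h.1 a
  have hra' := h.1 (a - 1)
  have hTn : T.ncard < n := by
    have hbT : b ∉ T := by
      rintro ⟨k, hk1, hk2, hk⟩
      have hk0 : (k : ZMod n) = 0 := by simpa using hk
      have := Nat.le_of_dvd hk1 ((ZMod.natCast_eq_zero_iff _ _).1 hk0)
      have := h.1 b
      omega
    have hss : T ⊂ Set.univ := Set.ssubset_univ_iff.2 fun h => hbT (h ▸ Set.mem_univ b)
    have := Set.ncard_lt_ncard hss
    rwa [Set.ncard_univ, Nat.card_zmod] at this
  have hcard : T.ncard = r a := by
    have hcast : (T.ncard : ZMod n) = (r a : ZMod n) := by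
      have h1 : a = b - (T.ncard : ZMod n) := ha
      have h2 : b = a + (r a : ZMod n) := hb
      linear_combination h1 + h2
    rw [← ZMod.val_cast_of_lt hTn, hcast, ZMod.val_cast_of_lt hra]
  have hinj : Set.InjOn (fun t : ℕ => a - 1 + (t : ZMod n)) (Set.Iio (r a + 1)) := by
    intro s hs t ht hst
    simp only [Set.mem_Iio] at hs ht
    have : (s : ZMod n) = (t : ZMod n) := add_left_cancel hst
    rw [← ZMod.val_cast_of_lt (show s < n by omega), this,
      ZMod.val_cast_of_lt (show t < n by omega)]
  have hsub : (fun t : ℕ => a - 1 + (t : ZMod n)) '' Set.Iio (r a + 1) ⊆ T := by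
    rintro _ ⟨t, ht, rfl⟩
    simp only [Set.mem_Iio] at ht
    have := h.le_add (a - 1) t
    refine ⟨r a + 1 - t, by omega, by dsimp only; omega, ?_⟩
    rw [Nat.cast_sub ht.le, hb, Fr]
    push_cast
    ring
  have h1 := Set.ncard_le_ncard hsub
  rw [hinj.ncard_image, hcard] at h1
  have h2 : (Set.Iio (r a + 1)).ncard = r a + 1 := by
    rw [← Finset.coe_Iio, Set.ncard_coe_finset, Nat.card_Iio]
  omega

lemma Disconnectable.natDisc {n : ℕ} [NeZero n] {r : ZMod n → ℕ} (h : IsRoundRep n r)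
    {a b : ZMod n} (hab : a ≠ b) (hd : Disconnectable r a b) :
    NatDisc n (fun k => r (k : ZMod n)) a.val b.val := by
  have hpred := hd.pred_le h
  have hb : b = a + (r a : ZMod n) := hd.1
  have hra := h.1 a
  have hv : ((r a : ZMod n)).val = r a := ZMod.val_cast_of_lt hra
  refine ⟨ZMod.val_lt a, ZMod.val_lt b, ?_, ?_, ?_⟩
  · simp only [ZMod.natCast_zmod_val]
    refine Nat.pos_of_ne_zero fun h0 => hab ?_
    simp [hb, h0]
  · simp only [ZMod.natCast_zmod_val]
    rcases lt_or_ge (a.val + r a) n with h1 | h1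
    · left
      rw [hb, ZMod.val_add_of_lt (by omega), hv]
    · right
      have := ZMod.val_add_val_of_le (a := a) (b := (r a : ZMod n)) (by omega)
      rw [← hb] at this
      omega
  · intro i hi hia
    have : (i : ZMod n) = a - 1 := by
      rw [eq_sub_iff_add_eq, ← Nat.cast_succ, ← ZMod.natCast_zmod_val a]
      rcases hia with h1 | ⟨h1, h2⟩
      · rw [← h1]
      · rw [h1, Nat.succ_eq_add_one, h2]
        simp
    simpa only [ZMod.natCast_zmod_val, this] using hpred

lemma NatRep.isPCA_deleteEdges_of_fiber_left {V : Type*} {G : SimpleGraph V} {n a b : ℕ}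
    {R : ℕ → ℕ} {β : V → ℕ} (h : NatRep G n R β) (hd : NatDisc n R a b) {B : Set V}
    (hB : B ⊆ β ⁻¹' {b}) (hne : B.Nonempty) :
    IsPCA (G.deleteEdges {e : Sym2 V | ∃ v ∈ β ⁻¹' {a}, ∃ w ∈ B, e = s(v, w)}) := by
  rcases hB.eq_or_ssubset with rfl | hss
  · exact (h.deleteEdges hd).isPCA
  obtain ⟨x, hxb, hxB⟩ := Set.exists_of_ssubset hss
  obtain ⟨y, hy⟩ := hne
  have hab : a ≠ b := by
    have := hd.eq
    have := hd.pos
    have := h.lt a hd.left_lt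
    omega
  have h' := h.split hd.right_lt (S := Bᶜ) ⟨x, hxB, hxb⟩ ⟨y, by simpa using hy, hB hy⟩
  have hA : splitMap β b Bᶜ ⁻¹' {if a < b then a else a + 1} = β ⁻¹' {a} := by
    ext v
    simp only [Set.mem_preimage, Set.mem_singleton_iff, splitMap]
    split_ifs <;> omega
  have hB' : splitMap β b Bᶜ ⁻¹' {b + 1} = B := by
    ext v
    have hv : v ∈ B → β v = b := fun hv => hB hv
    have hne : β v = b + 1 → v ∉ B := fun h1 h2 => by have := hv h2; omega
    simp only [Set.mem_preimage, Set.mem_singleton_iff, splitMap, Set.mem_compl_iff]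
    by_cases hvB : v ∈ B
    · simp [hvB, hv hvB]
    · simp only [hvB, not_false_eq_true, and_true, iff_false]
      split_ifs <;> omega
  have := (h'.deleteEdges (hd.split_right h.lt)).isPCA
  rwa [hA, hB'] at this

lemma NatRep.isPCA_deleteEdges {V : Type*} {G : SimpleGraph V} {n a b : ℕ}
    {R : ℕ → ℕ} {β : V → ℕ} (h : NatRep G n R β) (hd : NatDisc n R a b) {A B : Set V}
    (hA : A ⊆ β ⁻¹' {a}) (hB : B ⊆ β ⁻¹' {b}) (hAne : A.Nonempty) (hBne : B.Nonempty) :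
    IsPCA (G.deleteEdges {e : Sym2 V | ∃ v ∈ A, ∃ w ∈ B, e = s(v, w)}) := by
  rcases hA.eq_or_ssubset with rfl | hss
  · exact h.isPCA_deleteEdges_of_fiber_left hd hB hBne
  obtain ⟨x, hxa, hxA⟩ := Set.exists_of_ssubset hss
  obtain ⟨y, hy⟩ := hAne
  have hab : a ≠ b := by
    have := hd.eq
    have := hd.pos
    have := h.lt a hd.left_lt
    omega
  have h' := h.split hd.left_lt (S := A) ⟨y, hy, hA hy⟩ ⟨x, hxA, hxa⟩
  have hA' : splitMap β a A ⁻¹' {a} = A := by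
    ext v
    have hv : v ∈ A → β v = a := fun hv => hA hv
    simp only [Set.mem_preimage, Set.mem_singleton_iff, splitMap]
    by_cases hvA : v ∈ A
    · simp [hvA, hv hvA]
    · simp only [hvA, and_false, or_false, iff_false]
      split_ifs <;> omega
  have hB' : B ⊆ splitMap β a A ⁻¹' {if b < a then b else b + 1} := by
    intro v hv
    have hv : β v = b := hB hv
    simp only [Set.mem_preimage, Set.mem_singleton_iff, splitMap]
    split_ifs <;> omega
  have := h'.isPCA_deleteEdges_of_fiber_left (hd.split_left h.lt) hB' hBne
  rwa [hA'] at this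

theorem stmt12 {V : Type*} [Fintype V] (G : SimpleGraph V) (n : ℕ) (hn : 1 ≤ n)
    (r : ZMod n → ℕ) (β : V → ZMod n) (hrep : IsRoundRepOf G n r β)
    (hconn : (roundGraph r).Connected)
    (a b : ZMod n) (hab : a ≠ b) (hdisc : Disconnectable r a b)
    (Bl Br : Set V) (hBl : Bl ⊆ β ⁻¹' {a}) (hBr : Br ⊆ β ⁻¹' {b}) :
    IsPCA (G.deleteEdges {e : Sym2 V | ∃ v ∈ Bl, ∃ w ∈ Br, e = s(v, w)}) := by
  have : NeZero n := ⟨by omega⟩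
  rcases Bl.eq_empty_or_nonempty with rfl | hl
  · simpa using (show IsPCA G from ⟨n, hn, r, β, hrep⟩)
  rcases Br.eq_empty_or_nonempty with rfl | hr
  · simpa using (show IsPCA G from ⟨n, hn, r, β, hrep⟩)
  refine hrep.natRep.isPCA_deleteEdges (hdisc.natDisc hrep.1 hab) ?_ ?_ hl hr
  · exact fun v hv => congrArg ZMod.val (hBl hv)
  · exact fun v hv => congrArg ZMod.val (hBr hv)
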